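/- Let r ≥ 1 and let n_1, …, n_r, m_1, …, m_r be real numbers, each ≥ 1. Then P([n_1, m_1, n_2, m_2, …, n_r, m_r]) + P([m_1, n_2, m_2, …, m_{r−1}, n_r]) ≥ 2 + n_1 · m_1; in particular this quantity, which is the principal growth coefficient of the pair of friezes associated to a bridging triangulation of an annulus with fan sizes n_i, m_i, is strictly greater than 2. (For r = 1 the second list is empty and P([ ]) = 1.) -/

import Mathlib

/-- Auxiliary recursion on reversed lists: `contRev (x_k :: [x_{k-1}, …, x_1])` computes the
continuant `P(x_1, …, x_k)`. -/
noncomputable def contRev : List ℝ → ℝ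
  | [] => 1
  | [x] => x
  | x :: y :: t => x * contRev (y :: t) + contRev t

/-- The continuant `P` of a list of real numbers: `P [] = 1`, `P [x] = x` and
`P [x_1, …, x_k] = x_k · P [x_1, …, x_{k−1}] + P [x_1, …, x_{k−2}]`. -/
noncomputable def continuant (l : List ℝ) : ℝ := contRev l.reverse

/-- The full alternating list `[n_1, m_1, n_2, m_2, …, n_r, m_r]`. -/
def altList (nn mm : ℕ → ℝ) (r : ℕ) : List ℝ :=
  (List.range r).flatMap fun i => [nn (i + 1), mm (i + 1)]

theorem one_le_contRev (l : List ℝ) (h : ∀ x ∈ l, 1 ≤ x) : 1 ≤ contRev l := by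
  induction l using contRev.induct with
  | case1 => simp [contRev]
  | case2 x => simpa [contRev] using h
  | case3 x y t ih₁ ih₂ =>
    have hx : 1 ≤ x := h x (by simp)
    have h₁ := ih₁ fun z hz => h z (List.mem_cons_of_mem x hz)
    have h₂ := ih₂ fun z hz => h z (List.mem_cons_of_mem x (List.mem_cons_of_mem y hz))
    rw [contRev]
    nlinarith

theorem one_le_continuant (l : List ℝ) (h : ∀ x ∈ l, 1 ≤ x) : 1 ≤ continuant l :=
  one_le_contRev _ fun x hx => h x (List.mem_reverse.mp hx)

theorem continuant_append_pair (l : List ℝ) (a b : ℝ) :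
    continuant (l ++ [a, b]) = b * continuant (l ++ [a]) + continuant l := by
  simp [continuant, contRev]

theorem altList_succ (nn mm : ℕ → ℝ) (r : ℕ) :
    altList nn mm (r + 1) = altList nn mm r ++ [nn (r + 1), mm (r + 1)] := by
  simp [altList, List.range_succ]

theorem one_le_of_mem_altList (nn mm : ℕ → ℝ) (r : ℕ)
    (hn : ∀ i : ℕ, 1 ≤ i → i ≤ r → 1 ≤ nn i) (hm : ∀ i : ℕ, 1 ≤ i → i ≤ r → 1 ≤ mm i) :
    ∀ x ∈ altList nn mm r, 1 ≤ x := by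
  intro x hx
  simp only [altList, List.mem_flatMap, List.mem_range, List.mem_cons, List.not_mem_nil,
    or_false] at hx
  obtain ⟨i, hi, rfl | rfl⟩ := hx
  · exact hn _ (by omega) (by omega)
  · exact hm _ (by omega) (by omega)

theorem one_le_of_mem_altList_append (nn mm : ℕ → ℝ) (r : ℕ)
    (hn : ∀ i : ℕ, 1 ≤ i → i ≤ r + 1 → 1 ≤ nn i)
    (hm : ∀ i : ℕ, 1 ≤ i → i ≤ r + 1 → 1 ≤ mm i) :
    ∀ x ∈ altList nn mm r ++ [nn (r + 1)], 1 ≤ x := by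
  intro x hx
  refine one_le_of_mem_altList nn mm (r + 1) hn hm x ?_
  rw [altList_succ]
  simp only [List.mem_append, List.mem_cons, List.not_mem_nil, or_false] at hx ⊢
  tauto

theorem one_add_mul_le_continuant_altList (nn mm : ℕ → ℝ) (r : ℕ)
    (hn : ∀ i : ℕ, 1 ≤ i → i ≤ r + 1 → 1 ≤ nn i)
    (hm : ∀ i : ℕ, 1 ≤ i → i ≤ r + 1 → 1 ≤ mm i) :
    1 + nn 1 * mm 1 ≤ continuant (altList nn mm (r + 1)) := by
  induction r with
  | zero => simp [altList, continuant, contRev, add_comm, mul_comm]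
  | succ r ih =>
    have h := ih (fun i h₁ h₂ => hn i h₁ (by omega)) (fun i h₁ h₂ => hm i h₁ (by omega))
    have hO := one_le_continuant _ (one_le_of_mem_altList_append nn mm (r + 1) hn hm)
    have hb := hm (r + 1 + 1) (by omega) le_rfl
    rw [altList_succ, continuant_append_pair]
    nlinarith

/-- **Corollary (growth coefficient of an annulus frieze exceeds 2).**
For `r ≥ 1` and reals `n_1, …, n_r, m_1, …, m_r`, each `≥ 1`, the principal growth
coefficient `P([n_1, m_1, …, n_r, m_r]) + P([m_1, n_2, …, m_{r−1}, n_r])` is at least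
`2 + n_1·m_1`, and in particular strictly greater than `2`. -/
theorem growth_coefficient_gt_two
    (r : ℕ) (hr : 1 ≤ r) (nn mm : ℕ → ℝ)
    (hn : ∀ i : ℕ, 1 ≤ i → i ≤ r → 1 ≤ nn i)
    (hm : ∀ i : ℕ, 1 ≤ i → i ≤ r → 1 ≤ mm i) :
    2 + nn 1 * mm 1 ≤
        continuant (altList nn mm r)
          + continuant ((altList nn mm (r - 1) ++ [nn r]).tail) ∧
    2 < continuant (altList nn mm r)
          + continuant ((altList nn mm (r - 1) ++ [nn r]).tail) := by
  obtain ⟨k, rfl⟩ : ∃ k, r = k + 1 := ⟨r - 1, by omega⟩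
  have hE := one_add_mul_le_continuant_altList nn mm k hn hm
  have hT := one_le_continuant (altList nn mm k ++ [nn (k + 1)]).tail fun x hx =>
    one_le_of_mem_altList_append nn mm k hn hm x (List.mem_of_mem_tail hx)
  have h₁ := hn 1 le_rfl hr
  have h₂ := hm 1 le_rfl hr
  rw [Nat.add_sub_cancel]
  constructor
  · linarith
  · nlinarith
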